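/- Let N ∈ ℕ and let c : ℤ × ℤ → ℂ be a coefficient function of an element of ℂ((z₁⁻¹,z₂)) (i.e., there exist A, B ∈ ℤ with c(i,j) = 0 unless i ≤ A and j ≥ B). If the formal product (z₁−z₂)^N · c is identically zero, i.e. Σ_{k=0}^{N} (−1)^k C(N,k) c(i−N+k, j−k) = 0 for all (i,j) ∈ ℤ², then c = 0. In other words, multiplication by (z₁−z₂)^N is injective on ℂ((z₁⁻¹,z₂)). -/

import Mathlib

/-- The formal product of `(z₁ - z₂)^N` with the series having coefficient
function `c`, where `c (i, j)` is the coefficient of `z₁^i z₂^j`. -/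
noncomputable def mulPow (N : ℕ) (c : ℤ × ℤ → ℂ) : ℤ × ℤ → ℂ :=
  fun p => ∑ k ∈ Finset.range (N + 1),
    (-1 : ℂ) ^ k * (N.choose k : ℂ) * c (p.1 - N + k, p.2 - k)

/-- A coefficient function supported in `j ≥ B` vanishes as soon as its product with
`(z₁ - z₂)^N` does: the lowest surviving power of `z₂` is only hit by `z₁^N`. -/
theorem eq_zero_of_mulPow_eq_zero {N : ℕ} {c : ℤ × ℤ → ℂ} {B : ℤ}
    (hB : ∀ i j : ℤ, j < B → c (i, j) = 0) (hzero : ∀ p : ℤ × ℤ, mulPow N c p = 0) (n : ℕ) :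
    ∀ i j : ℤ, j < B + n → c (i, j) = 0 := by
  induction n with
  | zero => simpa using hB
  | succ n ih =>
    intro i j hj
    have key := hzero (i + N, j)
    rw [mulPow, Finset.sum_range_succ', Finset.sum_eq_zero] at key
    · simpa using key
    · intro k _
      rw [ih _ _ (by push_cast at hj ⊢; omega), mul_zero]

/-- multiplication by `(z₁ - z₂)^N` is injective on ℂ((z₁⁻¹,z₂)). -/
theorem mulPow_injective (N : ℕ) (c : ℤ × ℤ → ℂ)
    (h : ∃ A B : ℤ, ∀ i j : ℤ, ¬(i ≤ A ∧ B ≤ j) → c (i, j) = 0)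
    (hzero : ∀ p : ℤ × ℤ, mulPow N c p = 0) :
    ∀ p : ℤ × ℤ, c p = 0 := by
  obtain ⟨A, B, hAB⟩ := h
  rintro ⟨i, j⟩
  refine eq_zero_of_mulPow_eq_zero (B := B) (fun i j hj => hAB i j (by omega)) hzero
    (j - B + 1).toNat i j ?_
  omega
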